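/- Let k ≥ 2, 2 ≤ t ≤ k, D ≥ 1, and let f : ℝ^n → ℝ be a multilinear polynomial of degree at most D with ‖f‖_2 ≤ 1 under the standard Gaussian measure. Let G be the joint distribution of k standard Gaussian variables with covariance matrix (1+δ)I - δJ applied independently in each of n coordinates, and let H be the distribution of k independent standard Gaussian n-dimensional vectors. Then |E_{G^{⊗n}}[∏_{i=1}^t f(g_i)] - E_{H^{⊗n}}[∏_{i=1}^t f(h_i)]| ≤ δ·(2k)^{2kD}. -/

import Mathlib

open Finset MeasureTheory ProbabilityTheory

theorem integrable_pow_gaussianReal (m : ℕ) :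
    Integrable (fun x : ℝ => x ^ m) (gaussianReal 0 1) := by
  have h := (memLp_id_gaussianReal' (μ := 0) (v := 1) (m : ENNReal) (by simp)).integrable_norm_pow'
  refine h.mono' (by fun_prop) (ae_of_all _ fun x => ?_)
  simp

theorem integral_pow_succ_gaussianReal (m : ℕ) :
    ∫ x, x ^ (m + 1) ∂(gaussianReal 0 1) = m * ∫ x, x ^ (m - 1) ∂(gaussianReal 0 1) := by
  have key : ∀ j : ℕ, Integrable (fun x : ℝ => gaussianPDFReal 0 1 x * x ^ j) := by
    intro j
    have h := integrable_pow_gaussianReal j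
    rw [gaussianReal_of_var_ne_zero _ one_ne_zero,
      integrable_withDensity_iff_integrable_smul' (measurable_gaussianPDF 0 1)
        (ae_of_all _ fun _ => gaussianPDF_lt_top)] at h
    simpa [toReal_gaussianPDF] using h
  have hpdf : ∀ x, HasDerivAt (gaussianPDFReal 0 1) (-x * gaussianPDFReal 0 1 x) x := by
    intro x
    have h : HasDerivAt (fun y : ℝ => -(y - 0) ^ 2 / (2 * ((1 : NNReal) : ℝ))) (-x) x := by
      refine ((((hasDerivAt_id x).sub_const 0).pow 2).neg.div_const
        (2 * ((1 : NNReal) : ℝ))).congr_deriv ?_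
      simp
      ring
    rw [gaussianPDFReal_def]
    exact (h.exp.const_mul ((√(2 * Real.pi * ((1 : NNReal) : ℝ)))⁻¹)).congr_deriv (by ring)
  have hder : ∀ x : ℝ, HasDerivAt (fun y => gaussianPDFReal 0 1 y * y ^ m)
      (m * (gaussianPDFReal 0 1 x * x ^ (m - 1)) - gaussianPDFReal 0 1 x * x ^ (m + 1)) x := by
    intro x
    exact ((hpdf x).fun_mul (hasDerivAt_pow m x)).congr_deriv (by ring)
  have h0 := integral_eq_zero_of_hasDerivAt_of_integrable hder
    (((key (m - 1)).const_mul _).sub (key (m + 1))) (key m)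
  rw [integral_sub ((key (m - 1)).const_mul _) (key (m + 1)), integral_const_mul] at h0
  rw [integral_gaussianReal_eq_integral_smul one_ne_zero,
    integral_gaussianReal_eq_integral_smul one_ne_zero]
  simp only [smul_eq_mul]
  linarith

theorem pderiv_finset_prod {ι κ : Type*} [DecidableEq κ] (p : ι) (G : κ → MvPolynomial ι ℝ)
    (Y : Finset κ) :
    MvPolynomial.pderiv p (∏ y ∈ Y, G y) =
      ∑ y ∈ Y, MvPolynomial.pderiv p (G y) * ∏ z ∈ Y.erase y, G z := by
  induction Y using Finset.induction_on with
  | empty => simp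
  | insert a Y ha ih =>
    rw [prod_insert ha, sum_insert ha, Derivation.leibniz, ih, erase_insert ha, smul_eq_mul,
      smul_eq_mul, mul_sum, add_comm]
    congr 1
    · ring
    · refine sum_congr rfl fun y hy => ?_
      have hya : a ≠ y := fun h => ha (h ▸ hy)
      rw [erase_insert_of_ne hya, prod_insert (fun h => ha (mem_of_mem_erase h))]
      ring

section Wick

variable {ι : Type*} [Fintype ι]

theorem integrable_eval_pi_gaussianReal (P : MvPolynomial ι ℝ) :
    Integrable (fun ω => MvPolynomial.eval ω P) (Measure.pi fun _ : ι => gaussianReal 0 1) := by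
  induction P using MvPolynomial.induction_on' with
  | monomial e a =>
    simp only [MvPolynomial.eval_monomial]
    refine Integrable.const_mul ?_ a
    simp only [Finsupp.prod_fintype _ _ (fun _ => pow_zero _)]
    exact Integrable.fintype_prod (f := fun i (x : ℝ) => x ^ e i)
      fun i => integrable_pow_gaussianReal (e i)
  | add p q hp hq =>
    simp only [map_add]
    exact hp.fun_add hq

/-- The expectation of a polynomial in independent standard Gaussians. -/
noncomputable def gaussianExpectation (ι : Type*) [Fintype ι] : MvPolynomial ι ℝ →ₗ[ℝ] ℝ where
  toFun P := ∫ ω, MvPolynomial.eval ω P ∂(Measure.pi fun _ : ι => gaussianReal 0 1)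
  map_add' P Q := by
    simp only [map_add]
    exact integral_add (integrable_eval_pi_gaussianReal P) (integrable_eval_pi_gaussianReal Q)
  map_smul' a P := by
    simp only [MvPolynomial.smul_eval, RingHom.id_apply, smul_eq_mul]
    exact integral_const_mul _ _

theorem gaussianExpectation_monomial (e : ι →₀ ℕ) (a : ℝ) :
    gaussianExpectation ι (MvPolynomial.monomial e a) =
      a * ∏ i, ∫ x, x ^ e i ∂(gaussianReal 0 1) := by
  simp only [gaussianExpectation, LinearMap.coe_mk, AddHom.coe_mk, MvPolynomial.eval_monomial,
    integral_const_mul, Finsupp.prod_fintype _ _ (fun _ => pow_zero _)]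
  rw [integral_fintype_prod_eq_prod (fun i (x : ℝ) => x ^ e i)]

/-- Stein's identity for polynomials. -/
theorem gaussianExpectation_X_mul [DecidableEq ι] (p : ι) (P : MvPolynomial ι ℝ) :
    gaussianExpectation ι (MvPolynomial.X p * P) =
      gaussianExpectation ι (MvPolynomial.pderiv p P) := by
  induction P using MvPolynomial.induction_on' with
  | monomial e a =>
    rw [MvPolynomial.pderiv_monomial, MvPolynomial.X, MvPolynomial.monomial_mul, one_mul,
      gaussianExpectation_monomial, gaussianExpectation_monomial,
      ← Finset.mul_prod_erase _ _ (mem_univ p), ← Finset.mul_prod_erase _ _ (mem_univ p)]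
    have hrest : ∏ i ∈ univ.erase p, ∫ x, x ^ (Finsupp.single p 1 + e : ι →₀ ℕ) i
          ∂(gaussianReal 0 1) =
        ∏ i ∈ univ.erase p, ∫ x, x ^ (e - Finsupp.single p 1 : ι →₀ ℕ) i ∂(gaussianReal 0 1) := by
      refine prod_congr rfl fun i hi => ?_
      have : p ≠ i := (ne_of_mem_erase hi).symm
      simp [this]
    rw [hrest]
    have hp : (Finsupp.single p 1 + e : ι →₀ ℕ) p = e p + 1 := by simp [add_comm]
    have hp' : (e - Finsupp.single p 1 : ι →₀ ℕ) p = e p - 1 := by simp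
    rw [hp, hp', integral_pow_succ_gaussianReal]
    ring
  | add p q hp hq => simp only [mul_add, map_add, hp, hq]

/-- **Wick's formula**, in recursive form, for linear forms in independent Gaussians. -/
theorem gaussianExpectation_prod_insert [DecidableEq ι] {κ : Type*} [DecidableEq κ]
    (b : κ → ι → ℝ) {a : κ} {Y : Finset κ} (ha : a ∉ Y) :
    gaussianExpectation ι
        (∏ y ∈ insert a Y, ∑ p, MvPolynomial.C (b y p) * MvPolynomial.X p) =
      ∑ y ∈ Y, (∑ p, b a p * b y p) * gaussianExpectation ι
        (∏ z ∈ Y.erase y, ∑ p, MvPolynomial.C (b z p) * MvPolynomial.X p) := by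
  have hd : ∀ p y, MvPolynomial.pderiv p (∑ q, MvPolynomial.C (b y q) * MvPolynomial.X q) =
      MvPolynomial.C (b y p) := by
    intro p y
    simp [MvPolynomial.pderiv_X, Pi.single_apply]
  rw [prod_insert ha, sum_mul, map_sum]
  simp_rw [mul_assoc, MvPolynomial.C_mul', map_smul, gaussianExpectation_X_mul]
  simp_rw [← MvPolynomial.C_mul', pderiv_finset_prod, hd, map_sum, MvPolynomial.C_mul', map_smul,
    smul_eq_mul, mul_sum, sum_mul]
  rw [sum_comm]
  simp only [mul_assoc]

end Wick

section Rademacher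

theorem even_part_sq_add_odd_part_sq_le {I : Type*} (s : Finset I) (a b : I → ℝ) {k : ℕ}
    (hk : 0 < k) (hs : #s ≤ k) :
    ((∏ i ∈ s, (a i + b i) + ∏ i ∈ s, (a i - b i)) / 2) ^ 2 +
        (1 - #s / k) * ((∏ i ∈ s, (a i + b i) - ∏ i ∈ s, (a i - b i)) / 2) ^ 2 ≤
      ∏ i ∈ s, (a i ^ 2 + (4 * k + 1) * b i ^ 2) := by
  classical
  induction s using Finset.induction_on with
  | empty => simp
  | insert j s hj ih =>
    rw [card_insert_of_notMem hj] at hs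
    have ih' := ih (by omega)
    rw [prod_insert hj, prod_insert hj, prod_insert hj, card_insert_of_notMem hj]
    set p := ∏ i ∈ s, (a i + b i)
    set q := ∏ i ∈ s, (a i - b i)
    have hk' : (0 : ℝ) < k := by exact_mod_cast hk
    have hs' : (#s : ℝ) + 1 ≤ k := by exact_mod_cast hs
    refine le_trans ?_ (mul_le_mul_of_nonneg_left ih' (by positivity))
    push_cast
    generalize a j = x
    generalize b j = y
    obtain ⟨e, he⟩ : ∃ e, e = (p + q) / 2 := ⟨_, rfl⟩
    obtain ⟨o, ho⟩ : ∃ o, o = (p - q) / 2 := ⟨_, rfl⟩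
    obtain ⟨g, hg⟩ : ∃ g : ℝ, g = 1 - (#s + 1) / k := ⟨_, rfl⟩
    have h1 : ((x + y) * p + (x - y) * q) / 2 = x * e + y * o := by rw [he, ho]; ring
    have h2 : ((x + y) * p - (x - y) * q) / 2 = x * o + y * e := by rw [he, ho]; ring
    have h3 : (1 : ℝ) - #s / k = g + 1 / k := by rw [hg]; field_simp; ring
    rw [h1, h2, ← he, ← ho, h3, ← hg]
    have hg0 : 0 ≤ g := by
      rw [hg, sub_nonneg, div_le_one hk']; exact hs'
    have hg1 : g ≤ 1 := by
      rw [hg]; have : (0 : ℝ) ≤ (#s + 1) / k := by positivity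
      linarith
    have hc : (4 * (k : ℝ) + 1) * (g + 1 / k) - 1 ≥ 0 := by
      have : (4 * (k : ℝ) + 1) * (g + 1 / k) - 1 = (4 * k + 1) * g + 3 + 1 / k := by
        field_simp; ring
      rw [this]; positivity
    have hmain : 0 ≤ 1 / k * (x * o) ^ 2 + 4 * k * (y * e) ^ 2
        - 2 * (1 + g) * ((x * o) * (y * e)) := by
      have : 1 / k * (x * o) ^ 2 + 4 * k * (y * e) ^ 2 - 2 * (1 + g) * ((x * o) * (y * e)) =
        1 / k * (x * o - (1 + g) * k * (y * e)) ^ 2 + k * (4 - (1 + g) ^ 2) * (y * e) ^ 2 := by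
        field_simp; ring
      rw [this]
      have : 0 ≤ 4 - (1 + g) ^ 2 := by nlinarith
      positivity
    nlinarith [mul_nonneg hc (sq_nonneg (y * o)), mul_nonneg (sub_nonneg.2 hg1) (sq_nonneg (y * e))]

theorem prod_add_prod_sub_le {I : Type*} (s : Finset I) {k : ℕ} (hk : 0 < k) (hs : #s ≤ k)
    (a b : I → ℝ) :
    ∏ i ∈ s, (a i + b i) + ∏ i ∈ s, (a i - b i) ≤
      2 * ∏ i ∈ s, √(a i ^ 2 + (4 * k + 1) * b i ^ 2) := by
  have h := even_part_sq_add_odd_part_sq_le s a b hk hs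
  have hk' : (0 : ℝ) < k := by exact_mod_cast hk
  have h1 : 0 ≤ (1 - (#s : ℝ) / k) := by
    rw [sub_nonneg, div_le_one hk']; exact_mod_cast hs
  have h2 := abs_le_of_sq_le_sq (a := (∏ i ∈ s, (a i + b i) + ∏ i ∈ s, (a i - b i)) / 2)
    (b := ∏ i ∈ s, √(a i ^ 2 + (4 * k + 1) * b i ^ 2)) ?_ (by positivity)
  · linarith [h2, le_abs_self ((∏ i ∈ s, (a i + b i) + ∏ i ∈ s, (a i - b i)) / 2)]
  · rw [← prod_pow]
    simp_rw [fun i => Real.sq_sqrt (show 0 ≤ a i ^ 2 + (4 * k + 1) * b i ^ 2 by positivity)]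
    nlinarith [mul_nonneg h1 (sq_nonneg ((∏ i ∈ s, (a i + b i) - ∏ i ∈ s, (a i - b i)) / 2))]

theorem prod_add_add_prod_sub_eq_sum {I : Type*} [Fintype I] [DecidableEq I] (r : ℝ)
    (a b : I → ℝ) :
    ∏ i, (a i + r * b i) + ∏ i, (a i - r * b i) =
      ∑ S : Finset I, (r ^ #Sᶜ + (-r) ^ #Sᶜ) * ∏ i, if i ∈ S then a i else b i := by
  have h : ∀ r : ℝ, ∏ i, (a i + r * b i) =
      ∑ S : Finset I, r ^ #Sᶜ * ∏ i, if i ∈ S then a i else b i := by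
    intro r
    rw [Fintype.prod_add]
    refine sum_congr rfl fun S _ => ?_
    rw [prod_mul_distrib, prod_const, prod_ite]
    have h1 : univ.filter (· ∈ S) = S := by ext; simp
    have h2 : univ.filter (· ∉ S) = Sᶜ := by ext; simp
    rw [h1, h2]
    ring
  have h' := h (-r)
  simp only [neg_mul, ← sub_eq_add_neg] at h'
  rw [h, h', ← sum_add_distrib]
  simp only [add_mul]

theorem pow_add_neg_pow_nonneg {r : ℝ} (hr : 0 ≤ r) (m : ℕ) : 0 ≤ r ^ m + (-r) ^ m := by
  rcases Nat.even_or_odd m with h | h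
  · rw [h.neg_pow]; positivity
  · rw [h.neg_pow]; simp

/-- Hypercontractivity over the cube `{-r, r}^s`, for a product of multilinear polynomials. -/
theorem sum_prod_multilinear_le {I J : Type*} [Fintype I] [DecidableEq J] {k : ℕ} (hk : 0 < k)
    (hI : Fintype.card I ≤ k) {r : ℝ} (hr : 0 ≤ r) (s : Finset J) (c : I → Finset J → ℝ) :
    ∑ U ∈ s.powerset, ∏ i, ∑ T ∈ s.powerset, c i T * ∏ j ∈ T, (if j ∈ U then r else -r) ≤
      2 ^ #s * ∏ i, √(∑ T ∈ s.powerset, ((4 * k + 1) * r ^ 2) ^ #T * c i T ^ 2) := by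
  classical
  induction s using Finset.induction_on generalizing c with
  | empty =>
    simp only [powerset_empty, sum_singleton, prod_empty, card_empty, pow_zero, one_mul, mul_one]
    simp_rw [Real.sqrt_sq_eq_abs]
    rw [← abs_prod]
    exact le_abs_self _
  | insert j₀ s hj ih =>
    have hnot : ∀ {T}, T ∈ s.powerset → j₀ ∉ T := fun hT h => hj (mem_powerset.1 hT h)
    set N : (Finset J → ℝ) → ℝ := fun d => ∑ T ∈ s.powerset, ((4 * k + 1) * r ^ 2) ^ #T * d T ^ 2
      with hN
    have hN0 : ∀ d, 0 ≤ N d := fun d => sum_nonneg fun T _ => by positivity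
    set F : (Finset J → ℝ) → Finset J → ℝ :=
      fun d U => ∑ T ∈ s.powerset, d T * ∏ j ∈ T, (if j ∈ U then r else -r) with hF
    have hleft : ∀ U ∈ s.powerset, ∀ i,
        ∑ T ∈ (insert j₀ s).powerset, c i T * ∏ j ∈ T, (if j ∈ U then r else -r) =
          F (c i) U - r * F (fun T => c i (insert j₀ T)) U := by
      intro U hU i
      rw [sum_powerset_insert hj, sub_eq_add_neg, ← neg_mul, hF, mul_sum]
      congr 1
      refine sum_congr rfl fun T hT => ?_
      rw [prod_insert (hnot hT), if_neg (hnot hU)]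
      ring
    have hright : ∀ U ∈ s.powerset, ∀ i,
        ∑ T ∈ (insert j₀ s).powerset, c i T * ∏ j ∈ T, (if j ∈ insert j₀ U then r else -r) =
          F (c i) U + r * F (fun T => c i (insert j₀ T)) U := by
      intro U hU i
      have hs : ∀ T ∈ s.powerset, ∏ j ∈ T, (if j ∈ insert j₀ U then r else -r) =
          ∏ j ∈ T, (if j ∈ U then r else -r) := by
        intro T hT
        refine prod_congr rfl fun j hjT => ?_
        have : j ≠ j₀ := fun h => hnot hT (h ▸ hjT)
        simp [this]
      rw [sum_powerset_insert hj, hF, mul_sum]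
      congr 1
      · exact sum_congr rfl fun T hT => by rw [hs T hT]
      · refine sum_congr rfl fun T hT => ?_
        rw [prod_insert (hnot hT), if_pos (mem_insert_self _ _), hs T hT]
        ring
    have hnorm : ∀ i, ∑ T ∈ (insert j₀ s).powerset, ((4 * k + 1) * r ^ 2) ^ #T * c i T ^ 2 =
        √(N (c i)) ^ 2 + (4 * k + 1) * (r * √(N fun T => c i (insert j₀ T))) ^ 2 := by
      intro i
      rw [mul_pow, Real.sq_sqrt (hN0 _), Real.sq_sqrt (hN0 _), sum_powerset_insert hj, hN,
        ← mul_assoc, mul_sum]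
      congr 1
      refine sum_congr rfl fun T hT => ?_
      rw [card_insert_of_notMem (hnot hT)]
      ring
    simp_rw [hnorm]
    rw [sum_powerset_insert hj, ← sum_add_distrib]
    calc _ = ∑ U ∈ s.powerset, ∑ S : Finset I, (r ^ #Sᶜ + (-r) ^ #Sᶜ) *
          ∏ i, F (if i ∈ S then c i else fun T => c i (insert j₀ T)) U := by
          refine sum_congr rfl fun U hU => ?_
          simp_rw [hleft U hU, hright U hU]
          rw [add_comm, prod_add_add_prod_sub_eq_sum]
          refine sum_congr rfl fun S _ => ?_
          congr 1
          refine prod_congr rfl fun i _ => ?_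
          split_ifs <;> rfl
      _ = ∑ S : Finset I, (r ^ #Sᶜ + (-r) ^ #Sᶜ) * ∑ U ∈ s.powerset,
          ∏ i, F (if i ∈ S then c i else fun T => c i (insert j₀ T)) U := by
          rw [sum_comm]
          simp_rw [mul_sum]
      _ ≤ ∑ S : Finset I, (r ^ #Sᶜ + (-r) ^ #Sᶜ) * (2 ^ #s *
          ∏ i, √(N (if i ∈ S then c i else fun T => c i (insert j₀ T)))) :=
          sum_le_sum fun S _ => mul_le_mul_of_nonneg_left (ih _) (pow_add_neg_pow_nonneg hr _)
      _ = 2 ^ #s * (∏ i, (√(N (c i)) + r * √(N fun T => c i (insert j₀ T))) +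
          ∏ i, (√(N (c i)) - r * √(N fun T => c i (insert j₀ T)))) := by
          rw [prod_add_add_prod_sub_eq_sum, mul_sum]
          refine sum_congr rfl fun S _ => ?_
          rw [mul_left_comm]
          congr 2
          refine prod_congr rfl fun i _ => ?_
          split_ifs <;> rfl
      _ ≤ _ := by
          rw [card_insert_of_notMem hj, pow_succ, mul_assoc]
          exact mul_le_mul_of_nonneg_left (prod_add_prod_sub_le univ hk hI _ _) (by positivity)

/-- The sum over all `σ ∈ {-r, r}^J` of the monomial `∏ x ∈ X, σ x.2`. -/
def signSum {I J : Type*} [Fintype J] [DecidableEq J] (r : ℝ) (X : Finset (I × J)) : ℝ :=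
  ∑ U : Finset J, ∏ x ∈ X, (if x.2 ∈ U then r else -r)

variable {I J : Type*} [Fintype J] [DecidableEq J]

theorem signSum_empty (r : ℝ) : signSum r (∅ : Finset (I × J)) = 2 ^ Fintype.card J := by
  simp [signSum]

theorem signSum_nonneg {r : ℝ} (hr : 0 ≤ r) (X : Finset (I × J)) : 0 ≤ signSum r X := by
  have h : signSum r X =
      ∏ j, (r ^ #(X.filter fun x => x.2 = j) + (-r) ^ #(X.filter fun x => x.2 = j)) := by
    rw [Fintype.prod_add, signSum]
    refine sum_congr rfl fun U _ => ?_
    rw [← prod_fiberwise X (fun x => x.2), ← prod_mul_prod_compl U]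
    congr 1
    · refine prod_congr rfl fun j hj => ?_
      rw [← prod_const]
      exact prod_congr rfl fun x hx => by rw [(mem_filter.1 hx).2, if_pos hj]
    · refine prod_congr rfl fun j hj => ?_
      rw [← prod_const]
      exact prod_congr rfl fun x hx => by rw [(mem_filter.1 hx).2, if_neg (mem_compl.1 hj)]
  rw [h]
  exact prod_nonneg fun j _ => pow_add_neg_pow_nonneg hr _

theorem signSum_eq_sq_mul [DecidableEq I] (r : ℝ) {X : Finset (I × J)} {x y : I × J}
    (hx : x ∈ X) (hy : y ∈ X.erase x) (hxy : x.2 = y.2) :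
    signSum r X = r ^ 2 * signSum r ((X.erase x).erase y) := by
  rw [signSum, signSum, mul_sum]
  refine sum_congr rfl fun U _ => ?_
  rw [← mul_prod_erase X _ hx, ← mul_prod_erase _ _ hy, hxy, ← mul_assoc]
  congr 1
  split_ifs <;> ring

end Rademacher

theorem abs_gaussianExpectation_prod_mul_le {ι I J : Type*} [Fintype ι] [Fintype I] [Fintype J]
    [DecidableEq I] [DecidableEq J] {k : ℕ} (hk : 0 < k)
    (hI : Fintype.card I ≤ k) {κ : ℝ} (hκ : |κ| ≤ 1) (b : I × J → ι → ℝ)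
    (hb : ∀ x y, x ≠ y → ∑ p, b x p * b y p = if x.2 = y.2 then κ else 0)
    (X : Finset (I × J)) :
    |gaussianExpectation ι (∏ x ∈ X, ∑ p, MvPolynomial.C (b x p) * MvPolynomial.X p)| *
        2 ^ Fintype.card J ≤ (if X = ∅ then 1 else |κ|) * signSum √k X := by
  classical
  induction X using Finset.strongInduction with
  | H X ih =>
  rcases X.eq_empty_or_nonempty with rfl | ⟨a, ha⟩
  · have : gaussianExpectation ι 1 = 1 := by simp [gaussianExpectation]
    simp [signSum_empty, this]
  have hk' : (0 : ℝ) < k := by exact_mod_cast hk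
  have hW := signSum_nonneg (Real.sqrt_nonneg k) X
  rw [if_neg (ne_empty_of_mem ha)]
  conv_lhs => rw [← insert_erase ha]
  rw [gaussianExpectation_prod_insert b (notMem_erase a X)]
  have hterm : ∀ y ∈ X.erase a, |(∑ p, b a p * b y p) * gaussianExpectation ι
        (∏ z ∈ (X.erase a).erase y, ∑ p, MvPolynomial.C (b z p) * MvPolynomial.X p)| *
        2 ^ Fintype.card J ≤ if y.2 = a.2 then |κ| * signSum √k X / k else 0 := by
    intro y hy
    rw [hb a y (ne_of_mem_erase hy).symm]
    by_cases hay : a.2 = y.2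
    · rw [if_pos hay, if_pos hay.symm, abs_mul, mul_assoc, mul_div_assoc]
      refine mul_le_mul_of_nonneg_left ?_ (abs_nonneg _)
      rw [signSum_eq_sq_mul _ ha hy hay, Real.sq_sqrt hk'.le, mul_div_cancel_left₀ _ hk'.ne']
      refine (ih _ ((erase_subset _ _).trans_ssubset (erase_ssubset ha))).trans ?_
      refine mul_le_of_le_one_left (signSum_nonneg (Real.sqrt_nonneg k) _) ?_
      split_ifs
      · exact le_rfl
      · exact hκ
    · rw [if_neg hay, if_neg (Ne.symm hay)]
      simp
  have hcard : #((X.erase a).filter fun y => y.2 = a.2) ≤ k := by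
    refine le_trans ?_ hI
    refine card_le_card_of_injOn Prod.fst (fun _ _ => mem_univ _) fun y hy z hz h => ?_
    exact Prod.ext h ((mem_filter.1 hy).2.trans (mem_filter.1 hz).2.symm)
  calc _ ≤ (∑ y ∈ X.erase a, |(∑ p, b a p * b y p) * gaussianExpectation ι
        (∏ z ∈ (X.erase a).erase y, ∑ p, MvPolynomial.C (b z p) * MvPolynomial.X p)|) *
        2 ^ Fintype.card J :=
        mul_le_mul_of_nonneg_right (abs_sum_le_sum_abs _ _) (by positivity)
    _ ≤ ∑ y ∈ X.erase a, if y.2 = a.2 then |κ| * signSum √k X / k else 0 := by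
        rw [sum_mul]; exact sum_le_sum hterm
    _ = #((X.erase a).filter fun y => y.2 = a.2) * (|κ| * signSum √k X / k) := by
        rw [← sum_filter, sum_const, nsmul_eq_mul]
    _ ≤ k * (|κ| * signSum √k X / k) := by
        refine mul_le_mul_of_nonneg_right (by exact_mod_cast hcard) (by positivity)
    _ = |κ| * signSum √k X := by field_simp

theorem integral_prod_multilinear {I J L : Type*} [Fintype I] [Fintype J] [Fintype L]
    [DecidableEq I] [DecidableEq J] (c : Finset J → ℝ) (B : I → L → ℝ) :
    ∫ ω, (∏ i, ∑ T : Finset J, c T * ∏ j ∈ T, ∑ l, B i l * ω (l, j))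
        ∂(Measure.pi fun _ : L × J => gaussianReal 0 1) =
      ∑ T : I → Finset J, (∏ i, c (T i)) * gaussianExpectation (L × J)
        (∏ x ∈ univ.filter (fun x : I × J => x.2 ∈ T x.1),
          ∑ p : L × J, MvPolynomial.C (if p.2 = x.2 then B x.1 p.1 else 0) * MvPolynomial.X p) := by
  simp_rw [← smul_eq_mul (a := ∏ i, c _), ← map_smul, ← map_sum]
  simp only [gaussianExpectation, LinearMap.coe_mk, AddHom.coe_mk]
  congr 1
  funext ω
  simp only [map_sum, map_prod, map_mul, MvPolynomial.smul_eval, MvPolynomial.eval_C,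
    MvPolynomial.eval_X]
  rw [Fintype.prod_sum]
  refine sum_congr rfl fun T _ => ?_
  rw [prod_mul_distrib]
  congr 1
  rw [prod_filter, Fintype.prod_prod_type]
  refine prod_congr rfl fun i _ => ?_
  rw [← prod_filter]
  have : univ.filter (· ∈ T i) = T i := by ext; simp
  rw [this]
  refine prod_congr rfl fun j _ => ?_
  simp [Fintype.sum_prod_type, ite_mul]

theorem abs_integral_prod_multilinear_sub_le {I J L : Type*} [Fintype I] [Fintype J] [Fintype L]
    {k : ℕ} (hk : 0 < k) (hI : Fintype.card I ≤ k) {κ : ℝ} (hκ : |κ| ≤ 1) (c : Finset J → ℝ)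
    (B B' : I → L → ℝ) (hB : ∀ i i', i ≠ i' → ∑ l, B i l * B i' l = κ)
    (hB' : ∀ i i', i ≠ i' → ∑ l, B' i l * B' i' l = 0) :
    |∫ ω, (∏ i, ∑ T : Finset J, c T * ∏ j ∈ T, ∑ l, B i l * ω (l, j))
        ∂(Measure.pi fun _ : L × J => gaussianReal 0 1) -
      ∫ ω, (∏ i, ∑ T : Finset J, c T * ∏ j ∈ T, ∑ l, B' i l * ω (l, j))
        ∂(Measure.pi fun _ : L × J => gaussianReal 0 1)| ≤
      |κ| * √(∑ T : Finset J, ((4 * k + 1) * k : ℝ) ^ #T * c T ^ 2) ^ Fintype.card I := by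
  classical
  have hcov : ∀ (ρ : ℝ) (M : I → L → ℝ), (∀ i i', i ≠ i' → ∑ l, M i l * M i' l = ρ) →
      ∀ x y : I × J, x ≠ y → ∑ p : L × J, (if p.2 = x.2 then M x.1 p.1 else 0) *
        (if p.2 = y.2 then M y.1 p.1 else 0) = if x.2 = y.2 then ρ else 0 := by
    intro ρ M hM x y hxy
    by_cases h : x.2 = y.2
    · have h1 : x.1 ≠ y.1 := fun h' => hxy (Prod.ext h' h)
      rw [if_pos h, ← hM _ _ h1, Fintype.sum_prod_type]
      simp [h]
    · rw [if_neg h]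
      refine sum_eq_zero fun p _ => ?_
      by_cases h' : p.2 = x.2
      · rw [if_neg (fun h'' => h (h'.symm.trans h'')), mul_zero]
      · rw [if_neg h', zero_mul]
  rw [integral_prod_multilinear, integral_prod_multilinear, ← sum_sub_distrib]
  set E : (I → L → ℝ) → Finset (I × J) → ℝ := fun M X => gaussianExpectation (L × J)
    (∏ x ∈ X, ∑ p : L × J,
      MvPolynomial.C (if p.2 = x.2 then M x.1 p.1 else 0) * MvPolynomial.X p) with hE
  have hterm : ∀ X : Finset (I × J),
      |E B X - E B' X| * 2 ^ Fintype.card J ≤ |κ| * signSum √k X := by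
    intro X
    rcases X.eq_empty_or_nonempty with rfl | hX
    · simpa [hE] using mul_nonneg (abs_nonneg κ) (signSum_nonneg (Real.sqrt_nonneg k) _)
    · have h := abs_gaussianExpectation_prod_mul_le hk hI hκ _ (hcov κ B hB) X
      have h' := abs_gaussianExpectation_prod_mul_le hk hI (κ := 0) (by simp) _
        (hcov 0 B' hB') X
      rw [if_neg hX.ne_empty] at h h'
      have h0 : E B' X = 0 := by
        rw [abs_zero, zero_mul] at h'
        exact abs_nonpos_iff.1 (nonpos_of_mul_nonpos_left h' (by positivity))
      rwa [h0, sub_zero]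
  have hpow : (0 : ℝ) < 2 ^ Fintype.card J := by positivity
  have hr : √(k : ℝ) ^ 2 = k := Real.sq_sqrt (Nat.cast_nonneg k)
  have hhyper := sum_prod_multilinear_le hk hI (Real.sqrt_nonneg k) (univ : Finset J)
    (fun _ : I => fun T => |c T|)
  simp only [powerset_univ, sq_abs, hr, prod_const, card_univ] at hhyper
  refine le_of_mul_le_mul_right ?_ hpow
  calc _ ≤ (∑ T : I → Finset J, |(∏ i, c (T i)) *
          (E B (univ.filter fun x : I × J => x.2 ∈ T x.1) -
            E B' (univ.filter fun x : I × J => x.2 ∈ T x.1))|) * 2 ^ Fintype.card J := by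
        refine mul_le_mul_of_nonneg_right ?_ hpow.le
        simp_rw [mul_sub]
        exact abs_sum_le_sum_abs _ _
    _ ≤ ∑ T : I → Finset J, (∏ i, |c (T i)|) *
          (|κ| * signSum √k (univ.filter fun x : I × J => x.2 ∈ T x.1)) := by
        rw [sum_mul]
        refine sum_le_sum fun T _ => ?_
        rw [abs_mul, abs_prod, mul_assoc]
        exact mul_le_mul_of_nonneg_left (hterm _) (prod_nonneg fun i _ => abs_nonneg _)
    _ = |κ| * ∑ U : Finset J, ∏ _i : I, ∑ T : Finset J, |c T| *
          ∏ j ∈ T, (if j ∈ U then √k else -√k) := by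
        simp_rw [Fintype.prod_sum, signSum, mul_sum]
        rw [sum_comm]
        refine sum_congr rfl fun U _ => sum_congr rfl fun T _ => ?_
        rw [prod_mul_distrib, mul_left_comm]
        congr 2
        rw [prod_filter, Fintype.prod_prod_type]
        refine prod_congr rfl fun i _ => ?_
        rw [← prod_filter]
        have : univ.filter (· ∈ T i) = T i := by ext; simp
        rw [this]
    _ ≤ _ := by
        rw [mul_assoc, mul_comm (_ ^ Fintype.card I)]
        refine mul_le_mul_of_nonneg_left ?_ (abs_nonneg _)
        simpa only [prod_const, card_univ] using hhyper

/-- Replacing `δ`-negatively-correlated joint Gaussians by independent ones changes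
the expected product of `t` copies of a degree-≤`D` multilinear `f` (with
`‖f‖₂ ≤ 1`) by at most `δ·(2k)^{2kD}`. Here the joint distribution `G^{⊗n}` with
per-coordinate covariance `(1+δ)I - δJ` is realized as the image of i.i.d. standard
Gaussians under any matrix `A` with `A Aᵀ = (1+δ)I - δJ`. -/
theorem gaussian_independence_swap {n : ℕ} (k t D : ℕ) (hk : 2 ≤ k)
    (ht2 : 2 ≤ t) (htk : t ≤ k) (hD : 1 ≤ D) (δ : ℝ) (hδ : 0 < δ)
    (c : Finset (Fin n) → ℝ) (hdeg : ∀ T : Finset (Fin n), D < T.card → c T = 0)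
    (hnorm : ∑ T : Finset (Fin n), c T ^ 2 ≤ 1)
    (f : (Fin n → ℝ) → ℝ)
    (hf : ∀ x, f x = ∑ T : Finset (Fin n), c T * ∏ i ∈ T, x i)
    (A : Matrix (Fin k) (Fin k) ℝ)
    (hA : A * A.transpose = (1 + δ) • (1 : Matrix (Fin k) (Fin k) ℝ) -
      δ • Matrix.of (fun _ _ => (1 : ℝ))) :
    |(∫ ω, (∏ i ∈ Finset.univ.filter (fun i : Fin k => (i : ℕ) < t),
          f (fun j => ∑ l : Fin k, A i l * ω (l, j)))
        ∂(Measure.pi fun _ : Fin k × Fin n => gaussianReal 0 1)) -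
      ∫ ω, (∏ i ∈ Finset.univ.filter (fun i : Fin k => (i : ℕ) < t),
          f (fun j => ω (i, j)))
        ∂(Measure.pi fun _ : Fin k × Fin n => gaussianReal 0 1)| ≤
      δ * (2 * k) ^ (2 * k * D) := by
  have hk0 : 0 < k := by omega
  have hAent : ∀ i i', ∑ l, A i l * A i' l = (if i = i' then 1 + δ else 0) - δ := by
    intro i i'
    have h := congrFun (congrFun hA i) i'
    simp only [Matrix.mul_apply, Matrix.transpose_apply, Matrix.sub_apply, Matrix.smul_apply,
      Matrix.one_apply, Matrix.of_apply, smul_eq_mul, mul_ite, mul_one, mul_zero] at h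
    exact h
  have hδ1 : δ ≤ 1 := by
    have h : 0 ≤ ∑ l, (A ⟨0, by omega⟩ l + A ⟨1, by omega⟩ l) ^ 2 :=
      sum_nonneg fun _ _ => sq_nonneg _
    have he : ∑ l, (A ⟨0, by omega⟩ l + A ⟨1, by omega⟩ l) ^ 2 =
        ∑ l, A ⟨0, by omega⟩ l * A ⟨0, by omega⟩ l +
          2 * ∑ l, A ⟨0, by omega⟩ l * A ⟨1, by omega⟩ l +
          ∑ l, A ⟨1, by omega⟩ l * A ⟨1, by omega⟩ l := by
      rw [mul_sum, ← sum_add_distrib, ← sum_add_distrib]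
      exact sum_congr rfl fun _ _ => by ring
    rw [he, hAent, hAent, hAent] at h
    simp only [if_true, Fin.mk.injEq, zero_ne_one, if_false] at h
    linarith
  have hone : ∀ i i' : Fin k, ∑ l, (1 : Matrix (Fin k) (Fin k) ℝ) i l *
      (1 : Matrix (Fin k) (Fin k) ℝ) i' l = if i = i' then 1 else 0 := by
    intro i i'
    simp [Matrix.one_apply]
  set R := univ.filter (fun i : Fin k => (i : ℕ) < t)
  have hcard : Fintype.card R ≤ k := by
    simpa using card_le_univ R
  have hmain := abs_integral_prod_multilinear_sub_le (I := R) hk0 hcard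
    (κ := -δ) (by rw [abs_neg, abs_of_pos hδ]; exact hδ1) c (fun i => A i)
    (fun i => (1 : Matrix (Fin k) (Fin k) ℝ) i)
    (fun i i' h => by rw [hAent, if_neg (fun h' => h (Subtype.ext h'))]; ring)
    (fun i i' h => by rw [hone, if_neg (fun h' => h (Subtype.ext h'))])
  rw [abs_neg, abs_of_pos hδ] at hmain
  simp only [Matrix.one_apply, ite_mul, one_mul, zero_mul, sum_ite_eq, mem_univ, if_true] at hmain
  simp_rw [hf, ← prod_coe_sort R]
  refine hmain.trans (mul_le_mul_of_nonneg_left ?_ hδ.le)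
  have hk2 : (2 : ℝ) ≤ k := by exact_mod_cast hk
  have hsum : ∑ T : Finset (Fin n), ((4 * k + 1) * k : ℝ) ^ #T * c T ^ 2 ≤
      ((2 * k : ℝ) ^ (2 * D)) ^ 2 := by
    have hbase : ((4 * k + 1) * k : ℝ) ≤ (2 * k) ^ 4 := by
      nlinarith [mul_nonneg (sub_nonneg.2 hk2) (sub_nonneg.2 hk2),
        pow_nonneg (by linarith : (0 : ℝ) ≤ k) 3, pow_le_pow_left₀ (by norm_num) hk2 2,
        pow_le_pow_left₀ (by norm_num) hk2 3]
    calc _ ≤ ∑ T : Finset (Fin n), ((2 * k : ℝ) ^ (2 * D)) ^ 2 * c T ^ 2 := by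
          refine sum_le_sum fun T _ => ?_
          by_cases hT : D < #T
          · simp [hdeg T hT]
          · refine mul_le_mul_of_nonneg_right ?_ (sq_nonneg _)
            calc ((4 * k + 1) * k : ℝ) ^ #T ≤ ((2 * k) ^ 4) ^ #T :=
                  pow_le_pow_left₀ (by positivity) hbase _
              _ ≤ ((2 * k) ^ 4) ^ D :=
                  pow_le_pow_right₀ (one_le_pow₀ (by linarith)) (not_lt.1 hT)
              _ = ((2 * k : ℝ) ^ (2 * D)) ^ 2 := by rw [← pow_mul, ← pow_mul]; congr 1; ring
      _ ≤ _ := by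
          rw [← mul_sum]
          exact mul_le_of_le_one_right (by positivity) hnorm
  have hone_le : (1 : ℝ) ≤ (2 * k : ℝ) ^ (2 * D) := one_le_pow₀ (by linarith)
  calc _ ≤ ((2 * k : ℝ) ^ (2 * D)) ^ Fintype.card R :=
        pow_le_pow_left₀ (Real.sqrt_nonneg _) (Real.sqrt_le_iff.2 ⟨by positivity, hsum⟩) _
    _ ≤ ((2 * k : ℝ) ^ (2 * D)) ^ k := pow_le_pow_right₀ hone_le hcard
    _ = _ := by rw [← pow_mul]; congr 1; ring
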